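/- In the setup, for γ = (c, d, c_2, …, c_ℓ | i_0, j_2, …, j_ℓ) ∈ 𝒫_T(c,b)_{i_0} define f(γ) = (a, d, c_2, …, c_ℓ | i_1, j_2, …, j_ℓ), i.e. replace the first edge T_{i_0} by T_{i_1}. Then f is a well-defined bijection from 𝒫_T(c,b)_{i_0} onto 𝒫_T(a,b)_{i_1, -i_0}, and x(f(γ)) = (x_{i_1}/x_{i_0}) · x(γ) for every γ ∈ 𝒫_T(c,b)_{i_0}. (Lemma 2.6, map f.) -/

import Mathlib

open scoped BigOperators Classical

noncomputable section

/-- The `k`-th vertex of the regular `(n+3)`-gon inscribed in the unit circle. -/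
def vtx (n : ℕ) (k : Fin (n + 3)) : EuclideanSpace ℝ (Fin 2) :=
  (WithLp.equiv 2 (Fin 2 → ℝ)).symm
    ![Real.cos (2 * Real.pi * k / (n + 3)), Real.sin (2 * Real.pi * k / (n + 3))]

/-- `u` and `v` are cyclically adjacent vertices of the `(n+3)`-gon. -/
def Adj (n : ℕ) (u v : Fin (n + 3)) : Prop :=
  (u.val + 1) % (n + 3) = v.val ∨ (v.val + 1) % (n + 3) = u.val

/-- The pair `(u, v)` is a diagonal of the polygon. -/
def IsDiag (n : ℕ) (u v : Fin (n + 3)) : Prop :=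
  u ≠ v ∧ ¬ Adj n u v

/-- The open segments joining `u,v` and `w,z` intersect (the two edges cross). -/
def Cross (n : ℕ) (u v w z : Fin (n + 3)) : Prop :=
  (openSegment ℝ (vtx n u) (vtx n v) ∩ openSegment ℝ (vtx n w) (vtx n z)).Nonempty

/-- `(u,v)` and `(w,z)` are the same unordered pair of vertices. -/
def SamePair (n : ℕ) (u v w z : Fin (n + 3)) : Prop :=
  (u = w ∧ v = z) ∨ (u = z ∧ v = w)

/-- A triangulation of the `(n+3)`-gon: `2n+3` edges, the first `n` of which are
pairwise noncrossing diagonals (a maximal such family), and the remaining `n+3`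
are the boundary edges. -/
structure Triangulation (n : ℕ) where
  src : Fin (2 * n + 3) → Fin (n + 3)
  tgt : Fin (2 * n + 3) → Fin (n + 3)
  diag : ∀ i : Fin (2 * n + 3), i.val < n → IsDiag n (src i) (tgt i)
  bdry : ∀ i : Fin (2 * n + 3), n ≤ i.val → Adj n (src i) (tgt i)
  inj : ∀ i j : Fin (2 * n + 3), SamePair n (src i) (tgt i) (src j) (tgt j) → i = j
  noncross : ∀ i j : Fin (2 * n + 3), i ≠ j → ¬ Cross n (src i) (tgt i) (src j) (tgt j)
  bdry_complete : ∀ u v : Fin (n + 3), Adj n u v →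
    ∃ i : Fin (2 * n + 3), n ≤ i.val ∧ SamePair n (src i) (tgt i) u v
  maximal : ∀ u v : Fin (n + 3), IsDiag n u v →
    (∀ i : Fin (2 * n + 3), i.val < n → ¬ Cross n u v (src i) (tgt i)) →
    ∃ i : Fin (2 * n + 3), i.val < n ∧ SamePair n (src i) (tgt i) u v

/-- The edge `T_i` joins the vertices `u` and `v`. -/
def Joins (n : ℕ) (T : Triangulation n) (i : Fin (2 * n + 3)) (u v : Fin (n + 3)) : Prop :=
  SamePair n (T.src i) (T.tgt i) u v

/-- The edge `T_i` crosses the segment from `u` to `v`. -/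
def ECross (n : ℕ) (T : Triangulation n) (i : Fin (2 * n + 3)) (u v : Fin (n + 3)) : Prop :=
  Cross n (T.src i) (T.tgt i) u v

/-- The set of crossing points of the edge `T_i` with the segment from `u` to `v`. -/
def crossPts (n : ℕ) (T : Triangulation n) (i : Fin (2 * n + 3)) (u v : Fin (n + 3)) :
    Set (EuclideanSpace ℝ (Fin 2)) :=
  openSegment ℝ (vtx n (T.src i)) (vtx n (T.tgt i)) ∩ openSegment ℝ (vtx n u) (vtx n v)

/-- A default edge index. -/
def edef (n : ℕ) : Fin (2 * n + 3) := ⟨0, by omega⟩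

/-- The data of a path: the list of vertices `a_0,…,a_ℓ` and the list of
edge indices `i_1,…,i_ℓ`. -/
abbrev PathData (n : ℕ) := List (Fin (n + 3)) × List (Fin (2 * n + 3))

/-- `p` is a `T`-path from `a` to `b`: conditions (T1)–(T6). -/
def IsTPath (n : ℕ) (T : Triangulation n) (a b : Fin (n + 3)) (p : PathData n) : Prop :=
  -- the vertex list has one more entry than the edge list
  p.1.length = p.2.length + 1 ∧
  -- (T1)
  p.1.head? = some a ∧ p.1.getLast? = some b ∧
  -- (T2)
  (∀ k, k < p.2.length →
      Joins n T (p.2.getD k (edef n)) (p.1.getD k a) (p.1.getD (k + 1) a)) ∧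
  -- (T3)
  p.2.Nodup ∧
  -- (T4)
  Odd p.2.length ∧
  -- (T5) (list position `k` carries the `(k+1)`-st edge of the path)
  (∀ k, k < p.2.length → k % 2 = 1 → ECross n T (p.2.getD k (edef n)) a b) ∧
  -- (T6)
  (∀ j k, j < k → k < p.2.length →
      ∀ x ∈ crossPts n T (p.2.getD j (edef n)) a b,
      ∀ y ∈ crossPts n T (p.2.getD k (edef n)) a b,
        dist (vtx n a) x < dist (vtx n a) y)

/-- `𝒫_T(a,b)`: the set of `T`-paths from `a` to `b`. -/
def TPaths (n : ℕ) (T : Triangulation n) (a b : Fin (n + 3)) : Set (PathData n) :=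
  { p | IsTPath n T a b p }

/-- `𝒫_T(a,b)_j`: `T`-paths from `a` to `b` whose first edge is `T_j`. -/
def TPathsFirst (n : ℕ) (T : Triangulation n) (a b : Fin (n + 3)) (j : Fin (2 * n + 3)) :
    Set (PathData n) :=
  { p ∈ TPaths n T a b | p.2.head? = some j }

/-- `𝒫_T(a,b)_{-j}`: `T`-paths from `a` to `b` not containing the index `j`. -/
def TPathsAvoid (n : ℕ) (T : Triangulation n) (a b : Fin (n + 3)) (j : Fin (2 * n + 3)) :
    Set (PathData n) :=
  { p ∈ TPaths n T a b | j ∉ p.2 }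

/-- `𝒫_T(a,b)_{jk}`: `T`-paths from `a` to `b` whose first two edges are `T_j, T_k`. -/
def TPathsFirst2 (n : ℕ) (T : Triangulation n) (a b : Fin (n + 3))
    (j k : Fin (2 * n + 3)) : Set (PathData n) :=
  { p ∈ TPathsFirst n T a b j | p.2[1]? = some k }

/-- `𝒫_T(a,b)_{j,-k}`: `T`-paths from `a` to `b` whose first edge is `T_j` and which do
not contain the index `k`. -/
def TPathsFirstAvoid (n : ℕ) (T : Triangulation n) (a b : Fin (n + 3))
    (j k : Fin (2 * n + 3)) : Set (PathData n) :=
  { p ∈ TPathsFirst n T a b j | k ∉ p.2 }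

/-- The ambient field `F = ℚ(x_1,…,x_{2n+3})`. -/
abbrev F (n : ℕ) := FractionRing (MvPolynomial (Fin (2 * n + 3)) ℚ)

/-- The variable `x_i ∈ F` attached to the edge `T_i`. -/
def X (n : ℕ) (i : Fin (2 * n + 3)) : F n :=
  algebraMap (MvPolynomial (Fin (2 * n + 3)) ℚ) (F n) (MvPolynomial.X i)

/-- `x(α)` for a path with edge list `es = [i_1,…,i_ℓ]`: the product of the
variables of the odd edges times the inverse of the product of the variables of
the even edges (list position `k` carries the `(k+1)`-st edge). -/
def pathX (n : ℕ) (es : List (Fin (2 * n + 3))) : F n :=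
  (∏ k ∈ (Finset.range es.length).filter (fun k => k % 2 = 0), X n (es.getD k (edef n))) *
  (∏ k ∈ (Finset.range es.length).filter (fun k => k % 2 = 1), X n (es.getD k (edef n)))⁻¹

end

/-- Twice the signed area of the triangle `PQR`. -/
def signedArea (P Q R : EuclideanSpace ℝ (Fin 2)) : ℝ :=
  (Q 0 - P 0) * (R 1 - P 1) - (Q 1 - P 1) * (R 0 - P 0)

lemma signedArea_lineMap (P Q A B : EuclideanSpace ℝ (Fin 2)) (t : ℝ) :
    signedArea P Q (AffineMap.lineMap A B t) =
      (1 - t) * signedArea P Q A + t * signedArea P Q B := by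
  simp [signedArea, AffineMap.lineMap_apply]
  ring

lemma signedArea_left (P Q : EuclideanSpace ℝ (Fin 2)) : signedArea P Q P = 0 := by
  simp [signedArea]

lemma signedArea_right (P Q : EuclideanSpace ℝ (Fin 2)) : signedArea P Q Q = 0 := by
  simp [signedArea]
  ring

lemma signedArea_rotate (P Q R : EuclideanSpace ℝ (Fin 2)) :
    signedArea P Q R = signedArea Q R P := by
  simp only [signedArea]
  ring

lemma signedArea_swap (P Q R : EuclideanSpace ℝ (Fin 2)) :
    signedArea P Q R = -signedArea Q P R := by
  simp only [signedArea]
  ring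

lemma signedArea_eq_zero_of_mem {P Q x : EuclideanSpace ℝ (Fin 2)}
    (hx : x ∈ openSegment ℝ P Q) : signedArea P Q x = 0 := by
  rw [openSegment_eq_image_lineMap] at hx
  obtain ⟨t, -, rfl⟩ := hx
  simp [signedArea_lineMap, signedArea_left, signedArea_right]

lemma openSegment_inter_nonempty {P Q R S : EuclideanSpace ℝ (Fin 2)}
    (h₁ : signedArea P Q R * signedArea P Q S < 0)
    (h₂ : signedArea R S P * signedArea R S Q < 0) :
    (openSegment ℝ P Q ∩ openSegment ℝ R S).Nonempty := by
  have key : ∀ x y : ℝ, x * y < 0 → x - y ≠ 0 ∧ x / (x - y) ∈ Set.Ioo (0 : ℝ) 1 := by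
    intro x y h
    rcases mul_neg_iff.1 h with ⟨hx, hy⟩ | ⟨hx, hy⟩
    · have h0 : 0 < x - y := by linarith
      exact ⟨h0.ne', div_pos hx h0, (div_lt_one h0).2 (by linarith)⟩
    · have h0 : x - y < 0 := by linarith
      exact ⟨h0.ne, div_pos_of_neg_of_neg hx h0, (div_lt_one_of_neg h0).2 (by linarith)⟩
  obtain ⟨n₁, k₁⟩ := key _ _ h₁
  obtain ⟨n₂, k₂⟩ := key _ _ h₂
  rw [openSegment_eq_image_lineMap, openSegment_eq_image_lineMap]
  refine ⟨_, ⟨_, k₂, rfl⟩, ⟨_, k₁, ?_⟩⟩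
  ext i
  simp only [AffineMap.lineMap_apply, vsub_eq_sub, vadd_eq_add, PiLp.add_apply, PiLp.smul_apply,
    PiLp.sub_apply, smul_eq_mul]
  fin_cases i <;> simp only [Fin.zero_eta, Fin.mk_one, Fin.isValue]
  all_goals
    field_simp
    simp only [signedArea]
    ring

lemma dist_lt_of_signedArea {P Q R S A B x y : EuclideanSpace ℝ (Fin 2)}
    (hAB : signedArea P Q A * signedArea P Q B < 0)
    (hR : signedArea P Q A * signedArea P Q R ≤ 0)
    (hS : signedArea P Q A * signedArea P Q S ≤ 0)
    (hRS : ¬ (signedArea P Q R = 0 ∧ signedArea P Q S = 0))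
    (hx : x ∈ openSegment ℝ P Q ∩ openSegment ℝ A B)
    (hy : y ∈ openSegment ℝ R S ∩ openSegment ℝ A B) :
    dist A x < dist A y := by
  have hne : A ≠ B := by
    rintro rfl
    nlinarith [mul_self_nonneg (signedArea P Q A)]
  have hx0 := signedArea_eq_zero_of_mem hx.1
  obtain ⟨-, hx⟩ := hx
  obtain ⟨hy', hy⟩ := hy
  rw [openSegment_eq_image_lineMap] at hx hy hy'
  obtain ⟨t, ⟨ht, -⟩, rfl⟩ := hx
  obtain ⟨s, ⟨hs, -⟩, rfl⟩ := hy
  obtain ⟨r, ⟨hr, hr1⟩, hrs⟩ := hy'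
  have hys := congrArg (signedArea P Q) hrs
  rw [signedArea_lineMap, signedArea_lineMap] at hys
  rw [signedArea_lineMap] at hx0
  rw [dist_left_lineMap, dist_left_lineMap, Real.norm_of_nonneg ht.le, Real.norm_of_nonneg hs.le]
  refine mul_lt_mul_of_pos_right ?_ (dist_pos.2 hne)
  set α := signedArea P Q A
  set β := signedArea P Q B
  set ρ := signedArea P Q R
  set σ := signedArea P Q S
  have hα : α ≠ 0 := by
    intro h
    simp [h] at hAB
  have hneg : α * ((1 - s) * α + s * β) < 0 := by
    rw [← hys]
    have h1 : (1 - r) * (α * ρ) ≤ 0 := mul_nonpos_of_nonneg_of_nonpos (by linarith) hR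
    have h2 : r * (α * σ) ≤ 0 := mul_nonpos_of_nonneg_of_nonpos hr.le hS
    refine lt_of_le_of_ne (by linarith) fun h => hRS ?_
    have e1 : (1 - r) * (α * ρ) = 0 := by linarith
    have e2 : r * (α * σ) = 0 := by linarith
    have h3 : 1 - r ≠ 0 := by linarith
    simp only [mul_eq_zero, h3, hr.ne', hα, false_or] at e1 e2
    exact ⟨e1, e2⟩
  by_contra! hle
  have h4 : 0 ≤ (t - s) * (α * α - α * β) :=
    mul_nonneg (by linarith) (by nlinarith [mul_self_nonneg α])
  have h5 : α * ((1 - t) * α + t * β) = 0 := by rw [hx0, mul_zero]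
  nlinarith

/-- `p`, `q`, `r` are distinct and met in this order when the polygon is traversed
counterclockwise. -/
def Cyclic {n : ℕ} (p q r : Fin (n + 3)) : Prop :=
  (p.val < q.val ∧ q.val < r.val) ∨ (q.val < r.val ∧ r.val < p.val) ∨
    (r.val < p.val ∧ p.val < q.val)

/-- The vertices `w` and `z` lie strictly on opposite sides of the chord `uv`. -/
def Separates {n : ℕ} (u v w z : Fin (n + 3)) : Prop :=
  (Cyclic u v w ∧ Cyclic v u z) ∨ (Cyclic v u w ∧ Cyclic u v z)

lemma signedArea_vtx_pos_of_lt {n : ℕ} {p q r : Fin (n + 3)} (hpq : p.val < q.val)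
    (hqr : q.val < r.val) : 0 < signedArea (vtx n p) (vtx n q) (vtx n r) := by
  have hN : (0 : ℝ) < n + 3 := by positivity
  have hpq' : (p.val : ℝ) < q.val := by exact_mod_cast hpq
  have hqr' : (q.val : ℝ) < r.val := by exact_mod_cast hqr
  have hr : (r.val : ℝ) < n + 3 := by exact_mod_cast r.isLt
  have hp : (0 : ℝ) ≤ p.val := by positivity
  have hsin : ∀ x : ℝ, 0 < x → x < n + 3 → 0 < Real.sin (Real.pi * x / (n + 3)) := by
    intro x h0 h1
    refine Real.sin_pos_of_pos_of_lt_pi (by positivity) ?_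
    rw [div_lt_iff₀ hN]
    exact mul_lt_mul_of_pos_left h1 Real.pi_pos
  have h1 := hsin (q.val - p.val) (by linarith) (by linarith)
  have h2 := hsin (r.val - q.val) (by linarith) (by linarith)
  have h3 := hsin (r.val - p.val) (by linarith) (by linarith)
  have key : ∀ x y z : ℝ,
      (Real.cos (2 * y) - Real.cos (2 * x)) * (Real.sin (2 * z) - Real.sin (2 * x)) -
        (Real.sin (2 * y) - Real.sin (2 * x)) * (Real.cos (2 * z) - Real.cos (2 * x)) =
      4 * Real.sin (y - x) * Real.sin (z - y) * Real.sin (z - x) := by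
    intro x y z
    have e : (Real.cos (2 * y) - Real.cos (2 * x)) * (Real.sin (2 * z) - Real.sin (2 * x)) -
        (Real.sin (2 * y) - Real.sin (2 * x)) * (Real.cos (2 * z) - Real.cos (2 * x)) =
        Real.sin (2 * (y - x)) + Real.sin (2 * (z - y)) -
          Real.sin (2 * ((y - x) + (z - y))) := by
      rw [show 2 * (y - x) = 2 * y - 2 * x by ring, show 2 * (z - y) = 2 * z - 2 * y by ring,
        show 2 * ((y - x) + (z - y)) = 2 * z - 2 * x by ring, Real.sin_sub, Real.sin_sub,
        Real.sin_sub]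
      ring
    rw [e, show z - x = (y - x) + (z - y) by ring]
    generalize y - x = u
    generalize z - y = v
    rw [Real.sin_two_mul, Real.sin_two_mul, Real.sin_two_mul, Real.sin_add, Real.cos_add]
    have hu := Real.sin_sq_add_cos_sq u
    have hv := Real.sin_sq_add_cos_sq v
    linear_combination (-2 * Real.sin v * Real.cos v) * hu + (-2 * Real.sin u * Real.cos u) * hv
  have e : signedArea (vtx n p) (vtx n q) (vtx n r) =
      4 * Real.sin (Real.pi * (q.val - p.val) / (n + 3)) *
        Real.sin (Real.pi * (r.val - q.val) / (n + 3)) *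
        Real.sin (Real.pi * (r.val - p.val) / (n + 3)) := by
    have := key (Real.pi * p.val / (n + 3)) (Real.pi * q.val / (n + 3)) (Real.pi * r.val / (n + 3))
    simp only [← sub_div, ← mul_sub] at this
    rw [← this]
    simp [signedArea, vtx, mul_assoc, mul_div_assoc]
  rw [e]
  positivity

lemma signedArea_vtx_pos {n : ℕ} {p q r : Fin (n + 3)} (h : Cyclic p q r) :
    0 < signedArea (vtx n p) (vtx n q) (vtx n r) := by
  rcases h with h | h | h
  · exact signedArea_vtx_pos_of_lt h.1 h.2
  · rw [signedArea_rotate]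
    exact signedArea_vtx_pos_of_lt h.1 h.2
  · rw [← signedArea_rotate]
    exact signedArea_vtx_pos_of_lt h.1 h.2

lemma signedArea_vtx_neg {n : ℕ} {p q r : Fin (n + 3)} (h : Cyclic q p r) :
    signedArea (vtx n p) (vtx n q) (vtx n r) < 0 := by
  rw [signedArea_swap]
  linarith [signedArea_vtx_pos h]

lemma cyclic_cases {n : ℕ} {p q : Fin (n + 3)} (hpq : p ≠ q) (r : Fin (n + 3)) :
    Cyclic p q r ∨ Cyclic q p r ∨ r = p ∨ r = q := by
  simp only [Cyclic, Fin.ext_iff, ne_eq] at *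
  omega

lemma signedArea_vtx_eq_zero {n : ℕ} {p q r : Fin (n + 3)} (hpq : p ≠ q) :
    signedArea (vtx n p) (vtx n q) (vtx n r) = 0 ↔ r = p ∨ r = q := by
  constructor
  · intro h
    rcases cyclic_cases hpq r with h' | h' | h'
    · exact absurd h (signedArea_vtx_pos h').ne'
    · exact absurd h (signedArea_vtx_neg h').ne
    · exact h'
  · rintro (rfl | rfl)
    exacts [signedArea_left _ _, signedArea_right _ _]

lemma separates_iff {n : ℕ} {u v : Fin (n + 3)} (huv : u ≠ v) (w z : Fin (n + 3)) :
    Separates u v w z ↔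
      signedArea (vtx n u) (vtx n v) (vtx n w) * signedArea (vtx n u) (vtx n v) (vtx n z) < 0 := by
  constructor
  · rintro (⟨h1, h2⟩ | ⟨h1, h2⟩)
    · exact mul_neg_of_pos_of_neg (signedArea_vtx_pos h1) (signedArea_vtx_neg h2)
    · exact mul_neg_of_neg_of_pos (signedArea_vtx_neg h1) (signedArea_vtx_pos h2)
  · intro h
    rcases cyclic_cases huv w with h1 | h1 | h1
    · rcases cyclic_cases huv z with h2 | h2 | h2
      · exact absurd h (mul_pos (signedArea_vtx_pos h1) (signedArea_vtx_pos h2)).not_gt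
      · exact Or.inl ⟨h1, h2⟩
      · simp [(signedArea_vtx_eq_zero huv).2 h2] at h
    · rcases cyclic_cases huv z with h2 | h2 | h2
      · exact Or.inr ⟨h1, h2⟩
      · exact absurd h (mul_pos_of_neg_of_neg (signedArea_vtx_neg h1)
          (signedArea_vtx_neg h2)).not_gt
      · simp [(signedArea_vtx_eq_zero huv).2 h2] at h
    · simp [(signedArea_vtx_eq_zero huv).2 h1] at h

section Combinatorics

variable {n : ℕ} {a b c d p q r s u v w z : Fin (n + 3)}

lemma Separates.symm (h : Separates u v w z) : Separates w z u v := by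
  simp only [Separates, Cyclic] at *
  omega

lemma Separates.swap_left (h : Separates u v w z) : Separates v u w z := by
  simp only [Separates, Cyclic] at *
  omega

lemma Separates.swap_right (h : Separates u v w z) : Separates u v z w := by
  simp only [Separates, Cyclic] at *
  omega

lemma Separates.ne (h : Separates u v w z) :
    u ≠ v ∧ u ≠ w ∧ u ≠ z ∧ v ≠ w ∧ v ≠ z ∧ w ≠ z := by
  simp only [Separates, Cyclic, Fin.ext_iff, ne_eq] at *
  omega

lemma Separates.congr_samePair (h : SamePair n p q u v) :
    Separates p q w z ↔ Separates u v w z := by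
  rcases h with ⟨rfl, rfl⟩ | ⟨rfl, rfl⟩
  exacts [Iff.rfl, ⟨Separates.swap_left, Separates.swap_left⟩]

lemma Separates.of_not_separates (h : Separates p q a b) (hp : c ≠ p) (hq : c ≠ q)
    (h1 : ¬ Separates p q a c) :
    Separates p q c b := by
  rcases cyclic_cases h.ne.1 c with h' | h' | h' | h'
  · rcases h with h | h
    · exact Or.inl ⟨h', h.2⟩
    · exact absurd (Or.inr ⟨h.1, h'⟩) h1
  · rcases h with h | h
    · exact absurd (Or.inl ⟨h.1, h'⟩) h1
    · exact Or.inr ⟨h', h.2⟩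
  · exact absurd h' hp
  · exact absurd h' hq

lemma Separates.not_separates_of_left (h : Separates a q c b) (hcd : Separates c d a b)
    (h2 : ¬ Separates a q c d) : False := by
  rcases eq_or_ne d q with rfl | hdq
  · simp only [Separates, Cyclic] at *
    omega
  · have h4 : Separates a q d b :=
      h.of_not_separates hcd.ne.2.2.2.1 hdq h2
    clear h2
    rcases h with h | h <;> rcases h4 with h4 | h4 <;> rcases hcd with hcd | hcd <;>
      simp only [Cyclic] at * <;> omega

/-- A chord separating `c` from `b` that crosses no side of the triangle `acd`, where `cd`
separates `a` from `b`, also separates `a` from `b`. -/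
lemma Separates.of_triangle (h : Separates p q c b) (hcd : Separates c d a b)
    (h1 : ¬ Separates p q a c) (h2 : ¬ Separates p q c d) : Separates p q a b := by
  refine h.of_not_separates ?_ ?_ fun h' => h1 h'.swap_right
  · rintro rfl
    exact h.not_separates_of_left hcd h2
  · rintro rfl
    exact h.swap_left.not_separates_of_left hcd fun h' => h2 h'.swap_left

/-- The vertex `r` does not lie strictly on the side of the chord `pq` containing `a`. -/
def Beyond (p q a r : Fin (n + 3)) : Prop :=
  r = p ∨ r = q ∨ Separates p q a r

lemma Beyond.transfer (h : Beyond p q a r) (ha : Separates p q a b) (hc : Separates p q c b) :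
    Beyond p q c r := by
  rcases h with h | h | h
  · exact Or.inl h
  · exact Or.inr (Or.inl h)
  · refine Or.inr (Or.inr ?_)
    simp only [Separates, Cyclic] at *
    omega

lemma beyond_of_not_beyond (h : Separates p q a b) (h' : Separates r s a b)
    (hn : ¬ Separates p q r s) (hr : ¬ Beyond p q a r) : Beyond r s a p := by
  by_contra hp
  simp only [Beyond, not_or] at hr hp
  have hr' := h.of_not_separates hr.1 hr.2.1 hr.2.2
  have hp' := h'.of_not_separates hp.1 hp.2.1 hp.2.2
  clear hr hp
  rcases h with h | h <;> rcases h' with h' | h' <;> rcases hr' with hr' | hr' <;>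
    rcases hp' with hp' | hp' <;> simp only [Separates, Cyclic] at * <;> omega

lemma beyond_or_beyond (h : Separates p q a b) (h' : Separates r s a b)
    (hn : ¬ Separates p q r s) :
    (Beyond p q a r ∧ Beyond p q a s) ∨ (Beyond r s a p ∧ Beyond r s a q) := by
  have swap : ∀ {u v w z : Fin (n + 3)}, Beyond u v w z → Beyond v u w z := by
    rintro u v w z (h | h | h)
    exacts [Or.inr (Or.inl h), Or.inl h, Or.inr (Or.inr h.swap_left)]
  by_cases hr : Beyond p q a r
  · by_cases hs : Beyond p q a s
    · exact Or.inl ⟨hr, hs⟩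
    · exact Or.inr
        ⟨swap (beyond_of_not_beyond h h'.swap_left (fun k => hn k.swap_right) hs),
          swap (beyond_of_not_beyond h.swap_left h'.swap_left
            (fun k => hn k.swap_right.swap_left) fun k => hs (swap k))⟩
  · exact Or.inr
      ⟨beyond_of_not_beyond h h' hn hr,
        beyond_of_not_beyond h.swap_left h' (fun k => hn k.swap_left) fun k => hr (swap k)⟩

end Combinatorics

section Triangulation

variable {n : ℕ} {T : Triangulation n} {a b c d u v w x y z : Fin (n + 3)}
  {i j : Fin (2 * n + 3)}

lemma Adj.ne (h : Adj n u v) : u ≠ v := by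
  have key : ∀ k : Fin (n + 3), (k.val + 1) % (n + 3) ≠ k.val := by
    intro k hk
    rcases Nat.lt_or_ge (k.val + 1) (n + 3) with hlt | hge
    · rw [Nat.mod_eq_of_lt hlt] at hk
      omega
    · rw [show k.val + 1 = n + 3 by omega, Nat.mod_self] at hk
      omega
  rintro rfl
  rcases h with h | h <;> exact key u h

lemma Triangulation.src_ne_tgt (T : Triangulation n) (i : Fin (2 * n + 3)) :
    T.src i ≠ T.tgt i := by
  rcases Nat.lt_or_ge i.val n with h | h
  · exact (T.diag i h).1
  · exact (T.bdry i h).ne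

lemma cross_of_separates (h : Separates u v w z) : Cross n u v w z :=
  openSegment_inter_nonempty ((separates_iff h.ne.1 w z).1 h)
    ((separates_iff h.symm.ne.1 u v).1 h.symm)

lemma separates_of_cross (huv : u ≠ v) (hwz : w ≠ z) (hs : ¬ SamePair n u v w z)
    (h : Cross n u v w z) : Separates u v w z := by
  obtain ⟨x, hx, hx'⟩ := h
  have h0 := signedArea_eq_zero_of_mem hx
  rw [openSegment_eq_image_lineMap] at hx'
  obtain ⟨t, ⟨ht0, ht1⟩, rfl⟩ := hx'
  rw [signedArea_lineMap] at h0
  rw [separates_iff huv]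
  by_contra! hcon
  have hw := signedArea_vtx_eq_zero (r := w) huv
  have hz := signedArea_vtx_eq_zero (r := z) huv
  set α := signedArea (vtx n u) (vtx n v) (vtx n w)
  set β := signedArea (vtx n u) (vtx n v) (vtx n z)
  have e1 : (1 - t) * (α * α) + t * (α * β) = 0 := by linear_combination α * h0
  have hα : α = 0 := by
    have := mul_nonneg ht0.le hcon
    have h1 : 0 ≤ (1 - t) * (α * α) := mul_nonneg (by linarith) (mul_self_nonneg α)
    have h2 : (1 - t) * (α * α) = 0 := by linarith
    simpa [show 1 - t ≠ 0 by linarith] using h2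
  have hβ : β = 0 := by simpa [hα, ht0.ne'] using h0
  have hw' := hw.1 hα
  have hz' := hz.1 hβ
  simp only [SamePair] at hs
  grind

lemma Joins.symm (h : Joins n T i u v) : Joins n T i v u := by
  simp only [Joins, SamePair] at *
  tauto

lemma joins_self (T : Triangulation n) (i : Fin (2 * n + 3)) :
    Joins n T i (T.src i) (T.tgt i) := Or.inl ⟨rfl, rfl⟩

lemma Joins.ne (h : Joins n T i u v) : u ≠ v := by
  have := T.src_ne_tgt i
  rcases h with ⟨rfl, rfl⟩ | ⟨rfl, rfl⟩
  exacts [this, this.symm]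

lemma Joins.index_eq (h : Joins n T i u v) (h' : Joins n T j u v) : i = j := by
  refine T.inj i j ?_
  simp only [Joins, SamePair] at *
  grind

lemma Joins.not_separates (h : Joins n T i u v) (h' : Joins n T j w z) :
    ¬ Separates u v w z := by
  intro hs
  by_cases hij : i = j
  · subst hij
    have := hs.ne
    simp only [Joins, SamePair] at *
    grind
  · refine T.noncross i j hij (cross_of_separates ?_)
    rw [Separates.congr_samePair h]
    exact ((Separates.congr_samePair h').2 hs.symm).symm

/-- The edge `T_i` separates `u` from `v`. -/
def ESep (T : Triangulation n) (i : Fin (2 * n + 3)) (u v : Fin (n + 3)) : Prop :=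
  Separates (T.src i) (T.tgt i) u v

lemma ESep.eCross (h : ESep T i u v) : ECross n T i u v := cross_of_separates h

lemma ECross.eSep (huv : u ≠ v) (hs : ¬ Joins n T i u v) (h : ECross n T i u v) :
    ESep T i u v :=
  separates_of_cross (T.src_ne_tgt i) huv hs h

lemma eCross_iff_eSep (huv : u ≠ v) (hs : ¬ ∃ k, Joins n T k u v) :
    ECross n T i u v ↔ ESep T i u v :=
  ⟨ECross.eSep huv fun h => hs ⟨i, h⟩, ESep.eCross⟩

lemma ESep.not_joins (h : ESep T i u v) : ¬ ∃ k, Joins n T k u v :=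
  fun ⟨_, hk⟩ => (joins_self T i).not_separates hk h

lemma ESep.ne_left (h : ESep T i u v) : T.src i ≠ u ∧ T.tgt i ≠ u :=
  ⟨h.ne.2.1, h.ne.2.2.2.1⟩

/-- If `T_j` joins `x` and `y`, an edge that separates `x` from `b` and does not end at `y`
also separates `y` from `b`. -/
lemma ESep.transfer (h : ESep T i x b) (hj : Joins n T j x y)
    (hy : T.src i ≠ y ∧ T.tgt i ≠ y) : ESep T i y b :=
  Separates.of_not_separates h hy.1.symm hy.2.symm ((joins_self T i).not_separates hj)

/-- All crossing points of `T_i` with `M_{a,b}` are strictly closer to `a` than those of `T_j`. -/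
def CrossesBefore (T : Triangulation n) (i j : Fin (2 * n + 3)) (a b : Fin (n + 3)) : Prop :=
  ∀ x ∈ crossPts n T i a b, ∀ y ∈ crossPts n T j a b, dist (vtx n a) x < dist (vtx n a) y

/-- The edge `T_j` does not meet the open side of `T_i` containing `a`. -/
def EBeyond (T : Triangulation n) (i j : Fin (2 * n + 3)) (a : Fin (n + 3)) : Prop :=
  Beyond (T.src i) (T.tgt i) a (T.src j) ∧ Beyond (T.src i) (T.tgt i) a (T.tgt j)

lemma EBeyond.crossesBefore (hij : i ≠ j) (h : ESep T i a b) (hb : EBeyond T i j a) :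
    CrossesBefore T i j a b := by
  intro x hx y hy
  have hi := T.src_ne_tgt i
  have key : ∀ r, Beyond (T.src i) (T.tgt i) a r →
      signedArea (vtx n (T.src i)) (vtx n (T.tgt i)) (vtx n a) *
        signedArea (vtx n (T.src i)) (vtx n (T.tgt i)) (vtx n r) ≤ 0 := by
    rintro r (hr | hr | hr)
    · rw [(signedArea_vtx_eq_zero hi).2 (Or.inl hr), mul_zero]
    · rw [(signedArea_vtx_eq_zero hi).2 (Or.inr hr), mul_zero]
    · exact ((separates_iff hi _ _).1 hr).le
  refine dist_lt_of_signedArea ((separates_iff hi _ _).1 h) (key _ hb.1) (key _ hb.2) ?_ hx hy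
  rw [signedArea_vtx_eq_zero hi, signedArea_vtx_eq_zero hi]
  have hj := T.src_ne_tgt j
  have hinj := T.inj i j
  simp only [SamePair] at hinj
  grind

lemma eBeyond_iff_crossesBefore (hij : i ≠ j) (hi : ESep T i a b) (hj : ESep T j a b) :
    EBeyond T i j a ↔ CrossesBefore T i j a b := by
  refine ⟨EBeyond.crossesBefore hij hi, fun h => ?_⟩
  rcases beyond_or_beyond hi hj ((joins_self T i).not_separates (joins_self T j)) with hb | hb
  · exact hb
  · obtain ⟨x, hx⟩ := hi.eCross
    obtain ⟨y, hy⟩ := hj.eCross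
    have hb' : EBeyond T j i a := hb
    exact absurd (h x hx y hy) (hb'.crossesBefore hij.symm hj y hy x hx).not_gt

lemma EBeyond.transfer (h : EBeyond T i j x) (hx : ESep T i x b) (hy : ESep T i y b) :
    EBeyond T i j y :=
  ⟨h.1.transfer hx hy, h.2.transfer hx hy⟩

/-- Conditions (T1)-(T6) on what remains of a `T`-path from `x` to `b` after deleting its first
vertex `x` and its first edge, which ends at `d`. -/
def IsPathTail (n : ℕ) (T : Triangulation n) (x d b : Fin (n + 3)) (p : PathData n) : Prop :=
  p.1.length = p.2.length + 1 ∧ p.1.head? = some d ∧ p.1.getLast? = some b ∧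
  (∀ k, k < p.2.length →
      Joins n T (p.2.getD k (edef n)) (p.1.getD k b) (p.1.getD (k + 1) b)) ∧
  p.2.Nodup ∧ Even p.2.length ∧
  (∀ k, k < p.2.length → k % 2 = 0 → ESep T (p.2.getD k (edef n)) x b) ∧
  (∀ j k, j < k → k < p.2.length →
      CrossesBefore T (p.2.getD j (edef n)) (p.2.getD k (edef n)) x b)

lemma getD_congr {α : Type*} {l : List α} {k : ℕ} (h : k < l.length) (s t : α) :
    l.getD k s = l.getD k t := by
  rw [List.getD_eq_getElem _ _ h, List.getD_eq_getElem _ _ h]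

lemma crossPts_of_joins (hi : Joins n T i x d) (hxb : x ≠ b) (hdb : d ≠ b) :
    crossPts n T i x b = ∅ := by
  rw [← Set.not_nonempty_iff_eq_empty]
  intro h
  have hs : ¬ Joins n T i x b := by
    simp only [Joins, SamePair] at *
    grind
  have := (ECross.eSep hxb hs h).ne
  simp only [Joins, SamePair] at *
  grind

lemma isTPath_cons {vs : List (Fin (n + 3))} {es : List (Fin (2 * n + 3))} (hxb : x ≠ b)
    (hdb : d ≠ b) (hne : ¬ ∃ k, Joins n T k x b) (hi : Joins n T i x d) :
    IsTPath n T x b (x :: vs, i :: es) ↔ i ∉ es ∧ IsPathTail n T x d b (vs, es) := by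
  constructor
  · rintro ⟨h0, -, h1, h2, h3, h4, h5, h6⟩
    simp only [List.length_cons] at h0 h2 h4 h5 h6
    have hlen : vs.length = es.length + 1 := by omega
    obtain ⟨v, vs, rfl⟩ := List.exists_cons_of_length_eq_add_one hlen
    have hv : v = d := by
      have := h2 0 (by omega)
      simp only [List.getD_cons_zero, List.getD_cons_succ, zero_add] at this
      have hxd := hi.ne
      simp only [Joins, SamePair] at *
      grind
    refine ⟨(List.nodup_cons.1 h3).1, hlen, by simp [hv], by simpa using h1, ?_,
      (List.nodup_cons.1 h3).2, ?_, ?_, ?_⟩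
    · intro k hk
      have := h2 (k + 1) (by simpa using hk)
      simp only [List.getD_cons_succ] at this
      dsimp only at hk ⊢
      rwa [getD_congr (by omega) b x, getD_congr (by omega) b x]
    · rcases h4 with ⟨m, hm⟩
      exact ⟨m, by dsimp only; omega⟩
    · intro k hk hk2
      have := h5 (k + 1) (by simpa using hk) (by omega)
      exact (eCross_iff_eSep hxb hne).1 this
    · intro j k hjk hk
      exact h6 (j + 1) (k + 1) (by omega) (by simpa using hk)
  · rintro ⟨hi', h0, h1, h2, h3, h4, h5, h6, h7⟩
    dsimp only at *
    obtain ⟨v, vs, rfl⟩ := List.exists_cons_of_length_eq_add_one h0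
    obtain rfl : v = d := by simpa using h1
    refine ⟨by simpa using h0, rfl, by simpa using h2, ?_, List.nodup_cons.2 ⟨hi', h4⟩, ?_,
      ?_, ?_⟩
    · rintro (_ | k) hk
      · simpa using hi
      · simp only [List.length_cons, Nat.add_lt_add_iff_right] at hk
        have := h3 k hk
        simp only [List.getD_cons_succ]
        simp only [List.length_cons] at h0
        rwa [getD_congr (by simp; omega) x b, getD_congr (by omega) x b]
    · rcases h5 with ⟨m, hm⟩
      exact ⟨m, by simp only [List.length_cons]; omega⟩
    · rintro (_ | k) hk hk2
      · omega
      · exact (h6 k (by simpa using hk) (by omega)).eCross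
    · rintro (_ | j) (_ | k) hjk hk
      · omega
      · intro y hy
        simp only [List.getD_cons_zero, crossPts_of_joins hi hxb hdb] at hy
        exact absurd hy (Set.notMem_empty y)
      · omega
      · exact h7 j k (by omega) (by simpa using hk)

/-- Every vertex of a path tail is `b` or an endpoint of an edge in an even position. -/
lemma IsPathTail.forall_vertices {p : PathData n} (h : IsPathTail n T x d b p)
    {P : Fin (n + 3) → Prop} (hb : P b)
    (hP : ∀ k, k < p.2.length → k % 2 = 0 →
      P (T.src (p.2.getD k (edef n))) ∧ P (T.tgt (p.2.getD k (edef n)))) :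
    ∀ e ∈ p.2, P (T.src e) ∧ P (T.tgt e) := by
  obtain ⟨h0, -, h2, h3, -, ⟨m, hm⟩, -⟩ := h
  have hends : ∀ {e u v}, Joins n T e u v → (P (T.src e) ∧ P (T.tgt e) ↔ P u ∧ P v) := by
    rintro e u v (⟨rfl, rfl⟩ | ⟨rfl, rfl⟩)
    exacts [Iff.rfl, and_comm]
  have hv : ∀ k, k ≤ p.2.length → P (p.1.getD k b) := by
    intro k hk
    rcases hk.eq_or_lt with rfl | hk
    · have : p.1.getD p.2.length b = b := by
        rw [List.getLast?_eq_getElem?, h0, Nat.add_sub_cancel] at h2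
        simp [List.getD_eq_getElem?_getD, h2]
      rwa [this]
    · rcases Nat.mod_two_eq_zero_or_one k with h | h
      · exact ((hends (h3 k hk)).1 (hP k hk h)).1
      · obtain ⟨l, rfl⟩ : ∃ l, k = l + 1 := ⟨k - 1, by omega⟩
        exact ((hends (h3 l (by omega))).1 (hP l (by omega) (by omega))).2
  intro e he
  obtain ⟨k, hk, rfl⟩ := List.mem_iff_getElem.1 he
  have := h3 k hk
  rw [List.getD_eq_getElem _ _ hk] at this
  exact (hends this).2 ⟨hv k hk.le, hv (k + 1) hk⟩

/-- A path tail none of whose edges ends at `x` or `y`, where `xy` is an edge of `T`, is a tail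
for `x` if and only if it is one for `y`. -/
lemma IsPathTail.transfer {p : PathData n} (h : IsPathTail n T x d b p) (hj : Joins n T j x y)
    (hyb : y ≠ b) (hne : ¬ ∃ k, Joins n T k y b)
    (hx : ∀ e ∈ p.2, T.src e ≠ x ∧ T.tgt e ≠ x) (hy : ∀ e ∈ p.2, T.src e ≠ y ∧ T.tgt e ≠ y) :
    IsPathTail n T y d b p := by
  obtain ⟨h0, h1, h2, h3, h4, h5, h6, h7⟩ := h
  have hmem : ∀ k, k < p.2.length → p.2.getD k (edef n) ∈ p.2 := by
    intro k hk
    rw [List.getD_eq_getElem _ _ hk]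
    exact List.getElem_mem hk
  refine ⟨h0, h1, h2, h3, h4, h5, fun k hk hk2 => (h6 k hk hk2).transfer hj (hy _ (hmem k hk)), ?_⟩
  intro l k hlk hk
  have hne' : p.2.getD l (edef n) ≠ p.2.getD k (edef n) := by
    rw [List.getD_eq_getElem _ _ hk, List.getD_eq_getElem _ _ (hlk.trans hk)]
    exact fun h => hlk.ne ((h4.getElem_inj_iff).1 h)
  have hl' := hmem l (hlk.trans hk)
  have hk' := hmem k hk
  have H := h7 l k hlk hk
  generalize p.2.getD l (edef n) = e at *
  generalize p.2.getD k (edef n) = e' at *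
  intro u hu v hv
  have ey := (eCross_iff_eSep hyb hne).1 ⟨u, hu⟩
  have ey' := (eCross_iff_eSep hyb hne).1 ⟨v, hv⟩
  have ex := ey.transfer hj.symm (hx _ hl')
  have ex' := ey'.transfer hj.symm (hx _ hk')
  exact (((eBeyond_iff_crossesBefore hne' ex ex').2 H).transfer ex ey).crossesBefore hne' ey
    u hu v hv

lemma IsPathTail.exists_cons {vs : List (Fin (n + 3))} {es : List (Fin (2 * n + 3))}
    (h : IsPathTail n T x d b (vs, es)) (hdb : d ≠ b) :
    ∃ e es' v, es = e :: es' ∧ Joins n T e d v := by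
  obtain ⟨h0, h1, h2, h3, -⟩ := h
  dsimp only at *
  rcases es with _ | ⟨e, es⟩
  · obtain ⟨v, rfl⟩ := List.length_eq_one_iff.1 h0
    simp only [List.head?_cons, Option.some.injEq, List.getLast?_singleton] at h1 h2
    exact absurd (h1.symm.trans h2) hdb
  · obtain ⟨v, vs, rfl⟩ := List.exists_cons_of_length_eq_add_one h0
    obtain rfl : v = d := by simpa using h1
    exact ⟨e, es, _, rfl, by simpa using h3 0 (by simp)⟩

/-- If some `T`-path from `x` to `b` starts with an edge `xd` and `d ≠ b`, then `xb` is not an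
edge of `T`. -/
lemma IsTPath.not_joins {vs : List (Fin (n + 3))} {es : List (Fin (2 * n + 3))}
    (h : IsTPath n T x b (x :: vs, i :: es)) (hxb : x ≠ b) (hdb : d ≠ b)
    (hi : Joins n T i x d) : ¬ ∃ k, Joins n T k x b := by
  obtain ⟨h0, -, h1, h2, -, -, h5, -⟩ := h
  simp only [List.length_cons] at h0 h2 h5
  have hlen : vs.length = es.length + 1 := by omega
  obtain ⟨v, vs, rfl⟩ := List.exists_cons_of_length_eq_add_one hlen
  have hxd := hi.ne
  have hv : v = d := by
    have := h2 0 (by omega)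
    simp only [List.getD_cons_zero, List.getD_cons_succ, zero_add] at this
    simp only [Joins, SamePair] at *
    grind
  subst hv
  rcases es with _ | ⟨e, es⟩
  · obtain rfl : vs = [] := List.length_eq_zero_iff.1 (by simpa using h0)
    simp only [List.getLast?_cons_cons, List.getLast?_singleton, Option.some.injEq] at h1
    exact absurd h1 hdb
  · have hc := h5 1 (by simp) rfl
    have hj := h2 1 (by simp)
    simp only [List.getD_cons_zero, List.getD_cons_succ] at hc hj
    refine (hc.eSep hxb ?_).not_joins
    simp only [Joins, SamePair] at *
    grind

end Triangulation

lemma X_ne_zero (n : ℕ) (i : Fin (2 * n + 3)) : X n i ≠ 0 := by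
  rw [X, Ne, FaithfulSMul.algebraMap_eq_zero_iff]
  exact MvPolynomial.X_ne_zero i

lemma pathX_cons (n : ℕ) (i : Fin (2 * n + 3)) (es : List (Fin (2 * n + 3))) :
    pathX n (i :: es) = X n i * (pathX n es)⁻¹ := by
  have h0 : ∀ k, (k + 1) % 2 = 0 ↔ k % 2 = 1 := by omega
  have h1 : ∀ k, (k + 1) % 2 = 1 ↔ k % 2 = 0 := by omega
  simp only [pathX, Finset.prod_filter, List.length_cons, Finset.prod_range_succ', h0, h1,
    List.getD_cons_succ, List.getD_cons_zero, mul_inv, inv_inv]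
  simp
  ring

/-- In the triangle `acd`, with `cd` separating `a` from `b`, the tails of the `T`-paths from `c`
to `b` starting with `cd` are those of the `T`-paths from `a` to `b` starting with `ad` and not
using `cd`. -/
lemma isTPath_cons_iff {n : ℕ} {T : Triangulation n} {a b c d : Fin (n + 3)}
    {i0 i1 i1' : Fin (2 * n + 3)} (hM : ¬ ∃ i, Joins n T i a b) (hs : Separates c d a b)
    (hcd : Joins n T i0 c d) (hi1' : Joins n T i1' a c) (hi1 : Joins n T i1 a d)
    (vs : List (Fin (n + 3))) (es : List (Fin (2 * n + 3))) :
    IsTPath n T c b (c :: vs, i0 :: es) ↔ IsTPath n T a b (a :: vs, i1 :: es) ∧ i0 ∉ es := by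
  obtain ⟨-, -, hcb, hda, hdb, hab⟩ := hs.ne
  constructor
  · intro h
    have hcb' := h.not_joins hcb hdb hcd
    rw [isTPath_cons hcb hdb hcb' hcd] at h
    obtain ⟨hi0, h⟩ := h
    have hc : ∀ e ∈ es, T.src e ≠ c ∧ T.tgt e ≠ c :=
      h.forall_vertices (P := (· ≠ c)) hcb.symm fun k hk hk2 =>
        (h.2.2.2.2.2.2.1 k hk hk2).ne_left
    have ha : ∀ e ∈ es, T.src e ≠ a ∧ T.tgt e ≠ a :=
      h.forall_vertices (P := (· ≠ a)) hab.symm fun k hk hk2 =>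
        ESep.ne_left (v := b) ((h.2.2.2.2.2.2.1 k hk hk2).of_triangle hs
          ((joins_self T _).not_separates hi1') ((joins_self T _).not_separates hcd))
    refine ⟨(isTPath_cons hab hdb hM hi1).2
      ⟨fun hmem => ?_, h.transfer hi1'.symm hab hM hc ha⟩, hi0⟩
    have := ha i1 hmem
    rcases hi1 with hi1 | hi1
    exacts [this.1 hi1.1, this.2 hi1.2]
  · rintro ⟨h, hi0⟩
    rw [isTPath_cons hab hdb hM hi1] at h
    obtain ⟨-, h⟩ := h
    have ha : ∀ e ∈ es, T.src e ≠ a ∧ T.tgt e ≠ a :=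
      h.forall_vertices (P := (· ≠ a)) hab.symm fun k hk hk2 =>
        (h.2.2.2.2.2.2.1 k hk hk2).ne_left
    obtain ⟨e, es, v, rfl, he⟩ := h.exists_cons hdb
    have hea : ESep T e a b := h.2.2.2.2.2.2.1 0 (by simp) rfl
    have hec : T.src e ≠ c ∧ T.tgt e ≠ c := by
      have hne : ¬ Joins n T e c d := fun h' => hi0 (by simp [hcd.index_eq h'])
      have := hcd.ne
      simp only [Joins, SamePair] at he hne
      grind
    have hcb' := (hea.transfer hi1' hec).not_joins
    have hc : ∀ e' ∈ e :: es, T.src e' ≠ c ∧ T.tgt e' ≠ c := by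
      refine h.forall_vertices (P := (· ≠ c)) hcb.symm ?_
      rintro (_ | k) hk hk2
      · exact hec
      · have hnd : e ∉ es := (List.nodup_cons.1 h.2.2.2.2.1).1
        have hk' : k < es.length := by simpa using hk
        have hB := (eBeyond_iff_crossesBefore (fun heq => hnd ?_) hea
          (h.2.2.2.2.2.2.1 (k + 1) hk hk2)).2 (h.2.2.2.2.2.2.2 0 (k + 1) (by omega) hk)
        · have key : ¬ Beyond (T.src e) (T.tgt e) a c := by
            rintro (h' | h' | h')
            exacts [hec.1 h'.symm, hec.2 h'.symm, (joins_self T e).not_separates hi1' h']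
          exact ⟨fun h' => key (h' ▸ hB.1), fun h' => key (h' ▸ hB.2)⟩
        · simp only [List.getD_cons_succ, List.getD_eq_getElem _ _ hk'] at heq
          exact heq ▸ List.getElem_mem hk'
    exact (isTPath_cons hcb hdb hcb' hcd).2 ⟨hi0, h.transfer hi1' hcb hcb' ha hc⟩

/-- Lemma 2.6, the map `f`. -/
theorem bijOn_f
    (n : ℕ) (hn : 1 ≤ n) (T : Triangulation n) (a b c d : Fin (n + 3))
    (i0 i1 i1' : Fin (2 * n + 3))
    (hab : a ≠ b) (hnadj : ¬ Adj n a b)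
    (hM : ¬ ∃ i : Fin (2 * n + 3), Joins n T i a b)
    (hi0d : i0.val < n) (hi0M : ECross n T i0 a b)
    (hclosest : ∀ j : Fin (2 * n + 3), j.val < n → ECross n T j a b → j ≠ i0 →
      ∀ x ∈ crossPts n T i0 a b, ∀ y ∈ crossPts n T j a b,
        dist (vtx n a) x < dist (vtx n a) y)
    (hcd : Joins n T i0 c d)
    (hi1' : Joins n T i1' a c) (hi1 : Joins n T i1 a d)
    :
    Set.BijOn (fun γ : PathData n => ((a :: γ.1.tail, i1 :: γ.2.tail) : PathData n))
      (TPathsFirst n T c b i0) (TPathsFirstAvoid n T a b i1 i0) ∧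
    ∀ γ ∈ TPathsFirst n T c b i0,
      pathX n (i1 :: γ.2.tail) = X n i1 / X n i0 * pathX n γ.2 := by
  have hs : Separates c d a b :=
    (Separates.congr_samePair hcd).1 ((eCross_iff_eSep hab hM).1 hi0M)
  have key := isTPath_cons_iff hM hs hcd hi1' hi1
  have form : ∀ {x y : Fin (n + 3)} {i : Fin (2 * n + 3)} {p : PathData n},
      p ∈ TPathsFirst n T x y i → p = (x :: p.1.tail, i :: p.2.tail) := by
    rintro x y i ⟨vs, es⟩ ⟨hp, hi⟩
    have hx := hp.2.1
    dsimp only at hx hi ⊢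
    rw [List.cons_head?_tail hx, List.cons_head?_tail hi]
  refine ⟨⟨?_, ?_, ?_⟩, ?_⟩
  · intro γ hγ
    have h := hγ.1
    rw [form hγ] at h
    obtain ⟨h1, h2⟩ := (key _ _).1 h
    refine ⟨⟨h1, rfl⟩, ?_⟩
    have hne : i0 ≠ i1 := by
      rintro rfl
      have := hs.ne
      simp only [Joins, SamePair] at hcd hi1
      grind
    simpa [hne] using h2
  · intro γ hγ δ hδ h
    simp only [Prod.mk.injEq, List.cons.injEq, true_and] at h
    rw [form hγ, form hδ, h.1, h.2]
  · intro δ hδ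
    have hf := form hδ.1
    have h := hδ.1.1
    have h0 := hδ.2
    rw [hf] at h h0
    refine ⟨(c :: δ.1.tail, i0 :: δ.2.tail),
      ⟨(key _ _).2 ⟨h, fun hm => h0 (List.mem_cons_of_mem _ hm)⟩, rfl⟩, hf.symm⟩
  · intro γ hγ
    have h2 := congrArg Prod.snd (form hγ)
    rw [h2, List.tail_cons, pathX_cons, pathX_cons]
    field_simp [X_ne_zero n i0]
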